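/- Let Z ⊆ {0,1}^4 be the configuration Z = {(0,0,0,0),(1,1,0,0),(1,0,1,0),(0,1,1,0)} in Q_4. Then λ(Z,4) = 1/2. -/

import Mathlib

open Filter

namespace CubeDensity

/-- The automorphism of `Q_d` given by permuting coordinates by `σ` and then
complementing the values in the coordinates where `ε` is `true`. -/
def autMap (d : ℕ) (σ : Equiv.Perm (Fin d)) (ε : Fin d → Bool) (v : Fin d → Bool) :
    Fin d → Bool :=
  fun i => xor (v (σ⁻¹ i)) (ε i)

/-- `K` is an exact copy of `H` in `Q_d`: some automorphism of `Q_d` maps `H` onto `K`. -/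
def ExactCopy (d : ℕ) (H K : Set (Fin d → Bool)) : Prop :=
  ∃ σ : Equiv.Perm (Fin d), ∃ ε : Fin d → Bool, autMap d σ ε '' H = K

/-- The vertex of `Q_n` in the sub-`d`-cube with flip coordinates `F` (and fixed values `g`
outside `F`) corresponding to the vertex `u` of `Q_d`, identifying the flip coordinates
with `Fin d` in increasing order. -/
def embed {n d : ℕ} (F : Finset (Fin n)) (hF : F.card = d) (g : Fin n → Bool)
    (u : Fin d → Bool) : Fin n → Bool :=
  fun i => if h : i ∈ F then u ((F.orderIsoOfFin hF).symm ⟨i, h⟩) else g i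

/-- The sub-`d`-cube of `Q_n` with flip coordinates `F` and fixed values `g` outside `F`
is `H`-good for `S`: the configuration induced by `S` on it is an exact copy of `H`. -/
def IsGood {n d : ℕ} (H : Set (Fin d → Bool)) (S : Set (Fin n → Bool))
    (F : Finset (Fin n)) (hF : F.card = d) (g : Fin n → Bool) : Prop :=
  ExactCopy d H {u : Fin d → Bool | embed F hF g u ∈ S}

/-- The number of `H`-good sub-`d`-cubes of `Q_n`, where a sub-`d`-cube is encoded as a
pair `(F, g)` with `F` the `d`-element set of flip coordinates and `g` the fixed values
outside `F` (normalized to be `false` on `F`). -/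
noncomputable def goodCount (d : ℕ) (H : Set (Fin d → Bool)) (n : ℕ)
    (S : Set (Fin n → Bool)) : ℕ :=
  Nat.card {p : Finset (Fin n) × (Fin n → Bool) //
    ∃ hF : p.1.card = d, (∀ i ∈ p.1, p.2 i = false) ∧ IsGood H S p.1 hF p.2}

/-- `g(H,d,n,S)`: the fraction of the `C(n,d) * 2^(n-d)` sub-`d`-cubes of `Q_n` that are
`H`-good for `S`. -/
noncomputable def gFrac (d : ℕ) (H : Set (Fin d → Bool)) (n : ℕ)
    (S : Set (Fin n → Bool)) : ℝ :=
  (goodCount d H n S : ℝ) / ((n.choose d : ℝ) * 2 ^ (n - d))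

/-- `ex(H,d,n)`: the maximum over all `S ⊆ {0,1}^n` of the fraction of `H`-good
sub-`d`-cubes. -/
noncomputable def exD (d : ℕ) (H : Set (Fin d → Bool)) (n : ℕ) : ℝ :=
  ⨆ S : Set (Fin n → Bool), gFrac d H n S


/-- Flip one coordinate. -/
def flp {m : ℕ} (v : Fin m → Bool) (i : Fin m) : Fin m → Bool := Function.update v i (!(v i))

/-- Parity of the two-face at `v` with directions `i`, `j`. -/
def par {m : ℕ} (s : (Fin m → Bool) → Bool) (v : Fin m → Bool) (i j : Fin m) : Bool :=
  xor (xor (s v) (s (flp v i))) (xor (s (flp v j)) (s (flp (flp v i) j)))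

/-- Indicator function of `Z`. -/
def zb (w : Fin 4 → Bool) : Bool := !(w 3) && !(xor (xor (w 0) (w 1)) (w 2))

/-- The configuration `Z`. -/
def ZZ : Set (Fin 4 → Bool) := {![false, false, false, false], ![true, true, false, false],
          ![true, false, true, false], ![false, true, true, false]}

theorem mem_ZZ (w : Fin 4 → Bool) : w ∈ ZZ ↔ zb w = true := by
  simp only [ZZ, Set.mem_insert_iff, Set.mem_singleton_iff]
  revert w
  decide

theorem zb_par (w : Fin 4 → Bool) (i j : Fin 4) (h : i ≠ j) :
    par zb w i j = (decide (i = 3) || decide (j = 3)) := by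
  revert w i j
  decide

theorem perm_par (σ : Equiv.Perm (Fin 4)) (w : Fin 4 → Bool) :
    par zb w (σ 0) (σ 1) ≠ par zb w (σ 2) (σ 3) := by
  rw [zb_par _ _ _ (by simp), zb_par _ _ _ (by simp)]
  obtain ⟨a, ha⟩ := σ.surjective 3
  have h : ∀ b : Fin 4, σ b = 3 ↔ b = a := fun b => by
    conv_lhs => rw [← ha]
    exact σ.injective.eq_iff
  simp only [h]
  clear ha h
  clear w σ
  revert a
  decide

/-- Coordinate change. -/
def chg (σ : Equiv.Perm (Fin 4)) (ε : Fin 4 → Bool) (u : Fin 4 → Bool) : Fin 4 → Bool :=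
  fun i => xor (u (σ i)) (ε (σ i))

theorem mem_aut (σ : Equiv.Perm (Fin 4)) (ε u : Fin 4 → Bool) :
    u ∈ autMap 4 σ ε '' ZZ ↔ zb (chg σ ε u) = true := by
  rw [← mem_ZZ]
  constructor
  · rintro ⟨w, hw, rfl⟩
    convert hw
    funext i
    simp [chg, autMap]
  · intro h
    refine ⟨_, h, ?_⟩
    funext i
    simp [chg, autMap]

theorem chg_flp (σ : Equiv.Perm (Fin 4)) (ε u : Fin 4 → Bool) (i : Fin 4) :
    chg σ ε (flp u i) = flp (chg σ ε u) (σ⁻¹ i) := by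
  funext j
  by_cases h : σ j = i
  · subst h
    simp [chg, flp]
  · have h' : j ≠ σ⁻¹ i := by
      rintro rfl
      simp at h
    unfold flp
    rw [Function.update_of_ne h']
    simp only [chg, Function.update_of_ne h]

theorem embed_flp {n : ℕ} (F : Finset (Fin n)) (hF : F.card = 4) (g : Fin n → Bool)
    (u : Fin 4 → Bool) (a : Fin 4) :
    embed F hF g (flp u a) = flp (embed F hF g u) (F.orderEmbOfFin hF a) := by
  have hm : F.orderEmbOfFin hF a ∈ F := F.orderEmbOfFin_mem hF a
  have hs : (F.orderIsoOfFin hF).symm ⟨F.orderEmbOfFin hF a, hm⟩ = a := by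
    rw [OrderIso.symm_apply_eq]; rfl
  funext j
  by_cases h : j = F.orderEmbOfFin hF a
  · subst h
    simp [flp, embed, hm, hs]
  · have e : flp (embed F hF g u) (F.orderEmbOfFin hF a) j = embed F hF g u j :=
      Function.update_of_ne h _ _
    rw [e]
    by_cases hj : j ∈ F
    · simp only [embed, hj, dif_pos]
      rw [flp, Function.update_of_ne]
      intro h2
      apply h
      rw [OrderIso.symm_apply_eq] at h2
      have := congrArg Subtype.val h2
      exact this
    · simp [embed, hj]

theorem embed_emb {n : ℕ} (F : Finset (Fin n)) (hF : F.card = 4) (g : Fin n → Bool)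
    (u : Fin 4 → Bool) (a : Fin 4) : embed F hF g u (F.orderEmbOfFin hF a) = u a := by
  have hm : F.orderEmbOfFin hF a ∈ F := F.orderEmbOfFin_mem hF a
  have hs : (F.orderIsoOfFin hF).symm ⟨F.orderEmbOfFin hF a, hm⟩ = a := by
    rw [OrderIso.symm_apply_eq]; rfl
  simp [embed, hm, hs]

open Classical in
theorem good_mixed {n : ℕ} (S : Set (Fin n → Bool)) (F : Finset (Fin n)) (hF : F.card = 4)
    (g : Fin n → Bool) (hg : IsGood ZZ S F hF g) (u : Fin 4 → Bool) (τ : Equiv.Perm (Fin 4)) :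
    par (fun x => decide (x ∈ S)) (embed F hF g u)
      (F.orderEmbOfFin hF (τ 0)) (F.orderEmbOfFin hF (τ 1)) ≠
    par (fun x => decide (x ∈ S)) (embed F hF g u)
      (F.orderEmbOfFin hF (τ 2)) (F.orderEmbOfFin hF (τ 3)) := by
  obtain ⟨σ, ε, h⟩ := hg
  have key : ∀ w, decide (embed F hF g w ∈ S) = zb (chg σ ε w) := by
    intro w
    have : embed F hF g w ∈ S ↔ zb (chg σ ε w) = true := by
      rw [← mem_aut, h]; rfl
    simp [this]
  have key2 : ∀ a b, par (fun x => decide (x ∈ S)) (embed F hF g u)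
      (F.orderEmbOfFin hF a) (F.orderEmbOfFin hF b) = par zb (chg σ ε u) (σ⁻¹ a) (σ⁻¹ b) := by
    intro a b
    simp only [par, ← embed_flp, key, chg_flp]
  rw [key2, key2]
  exact perm_par (τ.trans σ⁻¹) (chg σ ε u)

theorem mixed_card {α : Type*} [Fintype α] [DecidableEq α] (f : α → Bool) :
    2 * (Finset.univ.filter (fun p : α × α => f p.1 ≠ f p.2)).card ≤ Fintype.card α ^ 2 := by
  set E := Finset.univ.filter (fun a : α => f a = true)
  set E' := Finset.univ.filter (fun a : α => ¬ (f a = true))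
  have h1 : E.card + E'.card = Fintype.card α := by
    rw [← Finset.card_univ]; exact Finset.card_filter_add_card_filter_not _
  have h2 : (Finset.univ.filter (fun p : α × α => f p.1 ≠ f p.2)) ⊆ E ×ˢ E' ∪ E' ×ˢ E := by
    rintro ⟨a, b⟩ h
    simp only [Finset.mem_filter, Finset.mem_univ, true_and, Finset.mem_union,
      Finset.mem_product, E, E'] at h ⊢
    revert h
    cases f a <;> cases f b <;> simp
  have h3 := (Finset.card_le_card h2).trans (Finset.card_union_le _ _)
  simp only [Finset.card_product] at h3
  rw [← h1]
  zify at *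
  nlinarith [sq_nonneg ((E.card : ℤ) - E'.card)]

open Classical in
theorem upper (n : ℕ) (S : Set (Fin n → Bool)) :
    768 * goodCount 4 ZZ n S ≤ 2 ^ n * n ^ 4 := by
  let X := {p : Finset (Fin n) × (Fin n → Bool) //
    ∃ hF : p.1.card = 4, (∀ i ∈ p.1, p.2 i = false) ∧ IsGood ZZ S p.1 hF p.2}
  let Q := (Fin n × Fin n) × (Fin n × Fin n)
  let f : (Fin n → Bool) → (Fin n × Fin n) → Bool :=
    fun v p => par (fun x => decide (x ∈ S)) v p.1 p.2
  let T := Σ v : (Fin n → Bool), {q : Q // f v q.1 ≠ f v q.2}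
  let Φ : X × (Fin 4 → Bool) × Equiv.Perm (Fin 4) → T := fun y =>
    ⟨embed y.1.1.1 y.1.2.choose y.1.1.2 y.2.1,
      ⟨((y.1.1.1.orderEmbOfFin y.1.2.choose (y.2.2 0), y.1.1.1.orderEmbOfFin y.1.2.choose (y.2.2 1)),
       (y.1.1.1.orderEmbOfFin y.1.2.choose (y.2.2 2), y.1.1.1.orderEmbOfFin y.1.2.choose (y.2.2 3))),
       good_mixed S _ _ _ y.1.2.choose_spec.2 _ _⟩⟩
  have hΦ : Function.Injective Φ := by
    rintro ⟨⟨⟨F, g⟩, hX⟩, u, σ⟩ ⟨⟨⟨F', g'⟩, hX'⟩, u', σ'⟩ h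
    have hv : embed F hX.choose g u = embed F' hX'.choose g' u' := congrArg Sigma.fst h
    have ht : ((F.orderEmbOfFin hX.choose (σ 0), F.orderEmbOfFin hX.choose (σ 1)),
        (F.orderEmbOfFin hX.choose (σ 2), F.orderEmbOfFin hX.choose (σ 3))) =
        ((F'.orderEmbOfFin hX'.choose (σ' 0), F'.orderEmbOfFin hX'.choose (σ' 1)),
        (F'.orderEmbOfFin hX'.choose (σ' 2), F'.orderEmbOfFin hX'.choose (σ' 3))) :=
      congrArg (fun z : T => z.2.1) h
    simp only [Prod.mk.injEq] at ht
    have ht' : ∀ a, F.orderEmbOfFin hX.choose (σ a) = F'.orderEmbOfFin hX'.choose (σ' a) := by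
      intro a
      fin_cases a
      · exact ht.1.1
      · exact ht.1.2
      · exact ht.2.1
      · exact ht.2.2
    have hFF : F = F' := by
      have e1 := F.range_orderEmbOfFin hX.choose
      have e2 := F'.range_orderEmbOfFin hX'.choose
      rw [← σ.surjective.range_comp] at e1
      rw [← σ'.surjective.range_comp] at e2
      have : (F : Set (Fin n)) = F' := by
        rw [← e1, ← e2]
        congr 1
        funext a
        exact ht' a
      exact_mod_cast this
    subst hFF
    have hσ : σ = σ' := by
      ext a
      have := (F.orderEmbOfFin hX.choose).injective (ht' a)
      rw [this]
    have hu : u = u' := by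
      funext a
      have := congrFun hv (F.orderEmbOfFin hX.choose a)
      rwa [embed_emb, embed_emb] at this
    have hg : g = g' := by
      funext i
      by_cases hi : i ∈ F
      · exact (hX.choose_spec.1 i hi).trans (hX'.choose_spec.1 i hi).symm
      · have := congrFun hv i
        simpa [embed, hi] using this
    subst hσ hu hg
    rfl
  have hcard := Fintype.card_le_of_injective Φ hΦ
  have h1 : Fintype.card (X × (Fin 4 → Bool) × Equiv.Perm (Fin 4)) =
      goodCount 4 ZZ n S * 384 := by
    rw [Fintype.card_prod, Fintype.card_prod, Fintype.card_perm, goodCount, Nat.card_eq_fintype_card]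
    simp [Nat.factorial, X]
  have h2 : 2 * Fintype.card T ≤ 2 ^ n * n ^ 4 := by
    rw [Fintype.card_sigma, Finset.mul_sum]
    refine (Finset.sum_le_card_nsmul _ _ (n ^ 4) ?_).trans ?_
    · intro v _
      rw [Fintype.card_subtype]
      refine (mixed_card (f v)).trans ?_
      simp only [Fintype.card_prod, Fintype.card_fin]
      apply le_of_eq; ring
    · simp
  omega

/-- Parity over colour class, on the big cube. -/
def phi {m : ℕ} (c x : Fin m → Bool) : ZMod 2 := ∑ i, if (c i && x i) then 1 else 0

/-- The extremal set. -/
def SS {n : ℕ} (c : Fin n → Bool) : Set (Fin n → Bool) :=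
  {x | phi c x = 0 ∧ phi (fun i => !(c i)) x = 0}

theorem phi_embed {n : ℕ} (F : Finset (Fin n)) (hF : F.card = 4) (g : Fin n → Bool)
    (u : Fin 4 → Bool) (c : Fin n → Bool) :
    phi c (embed F hF g u) = phi (fun a => c (F.orderEmbOfFin hF a)) u +
      ∑ i ∈ Fᶜ, if (c i && g i) then 1 else 0 := by
  unfold phi
  rw [← Finset.sum_add_sum_compl F]
  congr 1
  · rw [← Finset.sum_coe_sort F, ← (F.orderIsoOfFin hF).toEquiv.sum_comp]
    refine Finset.sum_congr rfl fun a _ => ?_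
    have : embed F hF g u ((F.orderIsoOfFin hF).toEquiv a : Fin n) = u a := embed_emb F hF g u a
    rw [this]
    rfl
  · refine Finset.sum_congr rfl fun i hi => ?_
    rw [Finset.mem_compl] at hi
    simp [embed, hi]

/-- Colouring with an odd number of `true`. -/
def oddc (c : Fin 4 → Bool) : Bool := xor (xor (c 0) (c 1)) (xor (c 2) (c 3))

theorem small_copy : ∀ c : Fin 4 → Bool, oddc c = true → ∀ α β : ZMod 2, ∃ l : Fin 4,
    ∃ a b : Bool, ∀ u : Fin 4 → Bool,
      (zb (chg (Equiv.swap l 3) (fun i => if i = l then a else if i = l + 1 then b else false) u) = true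
       ↔ (phi c u + α = 0 ∧ phi (fun i => !(c i)) u + β = 0)) := by
  decide +kernel

theorem good_of_odd {n : ℕ} (F : Finset (Fin n)) (hF : F.card = 4) (g c : Fin n → Bool)
    (h : oddc (fun a => c (F.orderEmbOfFin hF a)) = true) : IsGood ZZ (SS c) F hF g := by
  obtain ⟨l, a, b, hl⟩ := small_copy _ h (∑ i ∈ Fᶜ, if (c i && g i) then 1 else 0)
    (∑ i ∈ Fᶜ, if (!(c i) && g i) then 1 else 0)
  refine ⟨Equiv.swap l 3, fun i => if i = l then a else if i = l + 1 then b else false,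
    Set.ext fun u => ?_⟩
  rw [mem_aut]
  refine (hl u).trans ?_
  simp only [SS, Set.mem_setOf_eq, phi_embed]

/-- Does `F` meet the colouring oddly. -/
def oddF {n : ℕ} (F : Finset (Fin n)) (c : Fin n → Bool) : Prop :=
  ∃ hF : F.card = 4, oddc (fun a => c (F.orderEmbOfFin hF a)) = true

open Classical in
theorem half_odd {n : ℕ} (F : Finset (Fin n)) (hF : F.card = 4) :
    2 * (Finset.univ.filter (fun c : Fin n → Bool => oddF F c)).card = 2 ^ n := by
  have h1 : (Finset.univ.filter (fun c : Fin n → Bool => oddF F c)).card =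
      (Finset.univ.filter (fun c : Fin n → Bool => ¬ oddF F c)).card := by
    have hinv : ∀ c : Fin n → Bool, flp (flp c (F.orderEmbOfFin hF 0)) (F.orderEmbOfFin hF 0) = c := by
      intro c; simp [flp]
    have hodd : ∀ c : Fin n → Bool, oddF F (flp c (F.orderEmbOfFin hF 0)) ↔ ¬ oddF F c := by
      intro c
      have : (fun a => flp c (F.orderEmbOfFin hF 0) (F.orderEmbOfFin hF a)) =
          flp (fun a => c (F.orderEmbOfFin hF a)) 0 := by
        funext a
        by_cases h : a = 0
        · subst h; simp [flp]
        · simp [flp, h]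
      simp only [oddF, hF, exists_true_left, this]
      generalize (fun a => c (F.orderEmbOfFin hF a)) = d
      revert d
      decide
    refine Finset.card_bij' (fun c _ => flp c (F.orderEmbOfFin hF 0))
      (fun c _ => flp c (F.orderEmbOfFin hF 0)) ?_ ?_ ?_ ?_
    · intro c hc
      simp only [Finset.mem_filter, Finset.mem_univ, true_and] at hc ⊢
      rw [hodd]; exact not_not.2 hc
    · intro c hc
      simp only [Finset.mem_filter, Finset.mem_univ, true_and] at hc ⊢
      rw [hodd]; exact hc
    · intro c _; exact hinv c
    · intro c _; exact hinv c
  have h2 := Finset.card_filter_add_card_filter_not (s := (Finset.univ : Finset (Fin n → Bool)))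
    (fun c => oddF F c)
  have h3 : (Finset.univ : Finset (Fin n → Bool)).card = 2 ^ n := by simp
  omega

open Classical in
theorem exists_col (n : ℕ) : ∃ c : Fin n → Bool, n.choose 4 ≤
    2 * ((Finset.powersetCard 4 (Finset.univ : Finset (Fin n))).filter (fun F => oddF F c)).card := by
  by_contra! hcon
  have hs := Finset.sum_lt_sum_of_nonempty (s := (Finset.univ : Finset (Fin n → Bool)))
    Finset.univ_nonempty (fun c _ => hcon c)
  rw [← Finset.mul_sum] at hs
  have := Finset.sum_card_bipartiteAbove_eq_sum_card_bipartiteBelow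
    (s := (Finset.univ : Finset (Fin n → Bool)))
    (t := Finset.powersetCard 4 (Finset.univ : Finset (Fin n))) (fun c F => oddF F c)
  simp only [Finset.bipartiteAbove, Finset.bipartiteBelow] at this
  rw [this, Finset.mul_sum, Finset.sum_congr rfl (fun F hF => half_odd F (by
    simpa using hF))] at hs
  simp [mul_comm] at hs

open Classical in
theorem card_g {n : ℕ} (F : Finset (Fin n)) (hF : F.card = 4) :
    (Finset.univ.filter (fun g : Fin n → Bool => ∀ i ∈ F, g i = false)).card = 2 ^ (n - 4) := by
  have : (Finset.univ.filter (fun g : Fin n → Bool => ∀ i ∈ F, g i = false)) =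
      Fintype.piFinset (fun i => if i ∈ F then {false} else Finset.univ) := by
    ext g
    simp only [Finset.mem_filter, Finset.mem_univ, true_and, Fintype.mem_piFinset]
    refine forall_congr' fun i => ?_
    by_cases h : i ∈ F <;> simp [h]
  rw [this, Fintype.card_piFinset, ← Finset.prod_mul_prod_compl F]
  have e1 : ∀ i ∈ F, (if i ∈ F then ({false} : Finset Bool) else Finset.univ).card = 1 := by
    intro i hi; simp [hi]
  have e2 : ∀ i ∈ Fᶜ, (if i ∈ F then ({false} : Finset Bool) else Finset.univ).card = 2 := by
    intro i hi; rw [Finset.mem_compl] at hi; simp [hi]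
  rw [Finset.prod_congr rfl e1, Finset.prod_congr rfl e2]
  simp [Finset.card_compl, hF]

open Classical in
theorem lower (n : ℕ) : ∃ S : Set (Fin n → Bool),
    n.choose 4 * 2 ^ (n - 4) ≤ 2 * goodCount 4 ZZ n S := by
  obtain ⟨c, hc⟩ := exists_col n
  refine ⟨SS c, ?_⟩
  set P := (Finset.powersetCard 4 (Finset.univ : Finset (Fin n))).filter (fun F => oddF F c)
  have h1 : P.card * 2 ^ (n - 4) ≤ goodCount 4 ZZ n (SS c) := by
    rw [goodCount, Nat.card_eq_fintype_card, Fintype.card_subtype]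
    have h2 : (P.sigma fun F => Finset.univ.filter
        (fun g : Fin n → Bool => ∀ i ∈ F, g i = false)).card = P.card * 2 ^ (n - 4) := by
      rw [Finset.card_sigma, Finset.sum_congr rfl (fun F hF => card_g F (by
        simp only [P, Finset.mem_filter, Finset.mem_powersetCard] at hF
        exact hF.1.2))]
      simp
    rw [← h2]
    refine Finset.card_le_card_of_injOn (fun x => (x.1, x.2)) ?_ ?_
    · rintro ⟨F, g⟩ hx
      simp only [P, Finset.coe_sigma, Set.mem_sigma_iff, Finset.mem_coe, Finset.mem_filter,
        Finset.mem_univ, true_and] at hx ⊢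
      obtain ⟨⟨_, hF, ho⟩, hg⟩ := hx
      exact ⟨hF, hg, good_of_odd F hF g c ho⟩
    · rintro ⟨F, g⟩ _ ⟨F', g'⟩ _ h
      simp only [Prod.mk.injEq] at h
      obtain ⟨rfl, rfl⟩ := h
      rfl
  calc _ ≤ (2 * P.card) * 2 ^ (n - 4) := Nat.mul_le_mul_right _ hc
    _ = 2 * (P.card * 2 ^ (n - 4)) := by ring
    _ ≤ _ := Nat.mul_le_mul_left _ h1

theorem frac_le (n : ℕ) (hn : 4 ≤ n) (S : Set (Fin n → Bool)) :
    gFrac 4 ZZ n S ≤ 1 / 2 * ((n : ℝ) / ((n : ℝ) - 3)) ^ 4 := by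
  have hu : (768 : ℝ) * goodCount 4 ZZ n S ≤ 2 ^ n * (n : ℝ) ^ 4 := by exact_mod_cast upper n S
  have hd : ((n : ℝ) - 3) ^ 4 ≤ 24 * (n.choose 4 : ℝ) := by
    have h1 := Nat.pow_sub_le_descFactorial n 4
    rw [Nat.descFactorial_eq_factorial_mul_choose] at h1
    have h2 : ((n + 1 - 4 : ℕ) : ℝ) = (n : ℝ) - 3 := by
      rw [show n + 1 - 4 = n - 3 by omega, Nat.cast_sub (by omega)]; simp
    rw [← h2]
    exact_mod_cast h1
  have hn' : (4 : ℝ) ≤ n := by exact_mod_cast hn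
  have hpos : (0 : ℝ) < ((n : ℝ) - 3) ^ 4 := by
    have : (0 : ℝ) < (n : ℝ) - 3 := by linarith
    positivity
  have hc : (0 : ℝ) < n.choose 4 := by linarith
  have h2n : (2 : ℝ) ^ n = 16 * 2 ^ (n - 4) := by
    obtain ⟨k, rfl⟩ := Nat.exists_eq_add_of_le hn
    rw [pow_add]; norm_num
  have hp : (0 : ℝ) < 2 ^ (n - 4) := by positivity
  rw [gFrac, div_pow, div_le_iff₀ (by positivity)]
  rw [h2n] at hu
  have hG : (goodCount 4 ZZ n S : ℝ) ≤ 2 ^ (n - 4) * (n : ℝ) ^ 4 / 48 := by linarith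
  refine hG.trans ?_
  have h5 : (1 : ℝ) ≤ 24 * (n.choose 4 : ℝ) / ((n : ℝ) - 3) ^ 4 := by
    rw [le_div_iff₀ hpos]; linarith
  calc (2 : ℝ) ^ (n - 4) * (n : ℝ) ^ 4 / 48 = 2 ^ (n - 4) * (n : ℝ) ^ 4 / 48 * 1 := by ring
    _ ≤ 2 ^ (n - 4) * (n : ℝ) ^ 4 / 48 * (24 * (n.choose 4 : ℝ) / ((n : ℝ) - 3) ^ 4) :=
      mul_le_mul_of_nonneg_left h5 (by positivity)
    _ = _ := by ring

theorem ex_le (n : ℕ) (hn : 4 ≤ n) :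
    exD 4 ZZ n ≤ 1 / 2 * ((n : ℝ) / ((n : ℝ) - 3)) ^ 4 :=
  ciSup_le (frac_le n hn)

theorem le_ex (n : ℕ) (hn : 4 ≤ n) : 1 / 2 ≤ exD 4 ZZ n := by
  obtain ⟨S, hS⟩ := lower n
  have hb : BddAbove (Set.range fun S : Set (Fin n → Bool) => gFrac 4 ZZ n S) :=
    ⟨_, by rintro _ ⟨S, rfl⟩; exact frac_le n hn S⟩
  refine le_trans ?_ (le_ciSup hb S)
  have hc : (0 : ℝ) < n.choose 4 := by exact_mod_cast Nat.choose_pos hn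
  have hS' : (n.choose 4 : ℝ) * 2 ^ (n - 4) ≤ 2 * goodCount 4 ZZ n S := by exact_mod_cast hS
  show 1 / 2 ≤ gFrac 4 ZZ n S
  rw [gFrac, le_div_iff₀ (by positivity)]
  linarith

theorem lim_ub : Filter.Tendsto (fun n : ℕ => 1 / 2 * ((n : ℝ) / ((n : ℝ) - 3)) ^ 4)
    Filter.atTop (nhds (1 / 2 : ℝ)) := by
  have h : Filter.Tendsto (fun n : ℕ => (n : ℝ) / ((n : ℝ) + (-3))) Filter.atTop (nhds 1) :=
    tendsto_natCast_div_add_atTop (-3 : ℝ)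
  have := (h.pow 4).const_mul (1 / 2 : ℝ)
  simpa [sub_eq_add_neg] using this

end CubeDensity

/-- λ(Z, 4) = 1/2, where Z = {(0,0,0,0),(1,1,0,0),(1,0,1,0),(0,1,1,0)} in Q₄. -/
theorem dCubeDensity_Z :
    Filter.Tendsto
      (fun n => CubeDensity.exD 4
        ({![false, false, false, false], ![true, true, false, false],
          ![true, false, true, false], ![false, true, true, false]} : Set (Fin 4 → Bool)) n)
      Filter.atTop (nhds (1 / 2 : ℝ)) := by
  refine tendsto_of_tendsto_of_tendsto_of_le_of_le' tendsto_const_nhds CubeDensity.lim_ub ?_ ?_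
  · filter_upwards [Filter.eventually_ge_atTop 4] with n hn using CubeDensity.le_ex n hn
  · filter_upwards [Filter.eventually_ge_atTop 4] with n hn using CubeDensity.ex_le n hn
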